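/- arXiv:2505.00285 — 4 statements merged into one kernel-verified Lean document; each statement's English description precedes it below -/
import Mathlib

section
/- With 𝒜, Ā, and 𝒜^c = Ā − 𝒜 as defined, the block matrix U = [[𝒜^c, 𝒜],[𝒜, 𝒜^c]] is unitary; in particular Ā is a unitary completion of 𝒜. -/
noncomputable section
open Matrix BigOperators Finset

/-- Kronecker product of complex matrices, with the big-endian index identification
`i = p·i₁ + i₂` (first factor is the high-order register). -/
def kron {m n p q : ℕ} (A : Matrix (Fin m) (Fin n) ℂ) (B : Matrix (Fin p) (Fin q) ℂ) :
    Matrix (Fin (m * p)) (Fin (n * q)) ℂ :=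
  Matrix.of fun i j => A i.divNat j.divNat * B i.modNat j.modNat

/-- `l`-fold Kronecker power `B^{⊗l}`. -/
def kronPow {n : ℕ} (B : Matrix (Fin n) (Fin n) ℂ) : (l : ℕ) → Matrix (Fin (n ^ l)) (Fin (n ^ l)) ℂ
  | 0 => 1
  | l + 1 => kron (kronPow B l) B

/-- Recast a matrix along equalities of its dimensions. -/
def mcast {a b c d : ℕ} (h1 : a = b) (h2 : c = d) (M : Matrix (Fin a) (Fin c) ℂ) :
    Matrix (Fin b) (Fin d) ℂ :=
  M.submatrix (Fin.cast h1.symm) (Fin.cast h2.symm)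

/-- The commutation matrix `K^{(a,b)}`, the `ab × ab` permutation matrix determined by
`K (x ⊗ y) = y ⊗ x`: column `b·x + y` has its unique `1` in row `a·y + x`. -/
def commMat (a b : ℕ) : Matrix (Fin (a * b)) (Fin (a * b)) ℂ :=
  Matrix.of fun i j => if (i : ℕ) = a * ((j : ℕ) % b) + (j : ℕ) / b then 1 else 0

/-- τ0, τ1, τ2, τ3. -/
def τ : Fin 4 → Matrix (Fin 2) (Fin 2) ℂ
  | 0 => !![1, 0; 0, 0]
  | 1 => !![0, 1; 0, 0]
  | 2 => !![0, 0; 1, 0]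
  | 3 => !![0, 0; 0, 1]

/-- ρ0 = τ0, ρ1 = τ1, ρ2 = τ2, ρ3 = τ3, ρ4 = I₂. -/
def ρ : Fin 5 → Matrix (Fin 2) (Fin 2) ℂ
  | 0 => !![1, 0; 0, 0]
  | 1 => !![0, 1; 0, 0]
  | 2 => !![0, 0; 1, 0]
  | 3 => !![0, 0; 0, 1]
  | 4 => 1

def σx : Matrix (Fin 2) (Fin 2) ℂ := !![0, 1; 1, 0]

/-- ρ̄ = σx for ρ1, ρ2 and ρ̄ = I₂ for ρ0, ρ3, ρ4. -/
def ρbar : Fin 5 → Matrix (Fin 2) (Fin 2) ℂ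
  | 0 => 1
  | 1 => σx
  | 2 => σx
  | 3 => 1
  | 4 => 1

/-- The Kronecker product `f 0 ⊗ f 1 ⊗ ⋯ ⊗ f (Q−1)` of 2×2 matrices (leftmost factor
is the most significant register). -/
def kronSeq : (Q : ℕ) → (Fin Q → Matrix (Fin 2) (Fin 2) ℂ) → Matrix (Fin (2 ^ Q)) (Fin (2 ^ Q)) ℂ
  | 0, _ => 1
  | Q + 1, f => kron (kronSeq Q fun k => f k.castSucc) (f (Fin.last Q))

/-- A (real) permutation matrix: a 0/1 matrix with exactly one 1 in each row and column. -/
def IsPermMatrix {N : ℕ} (M : Matrix (Fin N) (Fin N) ℂ) : Prop :=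
  (∀ i j, M i j = 0 ∨ M i j = 1) ∧ (∀ i, ∃! j, M i j = 1) ∧ (∀ j, ∃! i, M i j = 1)

/-- 𝒟 = τ0^{⊗s} ⊗ I_{n_x}, where n_x = 2^s. -/
def Dmat (s : ℕ) : Matrix (Fin ((2 ^ s) ^ 2)) (Fin ((2 ^ s) ^ 2)) ℂ :=
  mcast (by ring) (by ring) (kron (kronPow (τ 0) s) (1 : Matrix (Fin (2 ^ s)) (Fin (2 ^ s)) ℂ))

/-- The middle factor (τ0^{⊗s} ⊗ K^{(n_x^l,n_x)}) · (𝒟P ⊗ I_{n_x}^{⊗l}) · K^{(n_x²,n_x^l)}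
of 𝒜. -/
def midA (s l : ℕ) (P : Matrix (Fin ((2 ^ s) ^ 2)) (Fin ((2 ^ s) ^ 2)) ℂ) :
    Matrix (Fin ((2 ^ s) ^ (l + 2))) (Fin ((2 ^ s) ^ (l + 2))) ℂ :=
  mcast (by ring) (by ring) (kron (kronPow (τ 0) s) (commMat ((2 ^ s) ^ l) (2 ^ s))) *
    mcast (by ring) (by ring)
      (kron (Dmat s * P) (1 : Matrix (Fin ((2 ^ s) ^ l)) (Fin ((2 ^ s) ^ l)) ℂ)) *
    mcast (by ring) (by ring) (commMat ((2 ^ s) ^ 2) ((2 ^ s) ^ l))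

/-- The middle factor (I_{n_x} ⊗ K^{(n_x^l,n_x)}) · (P ⊗ I_{n_x}^{⊗l}) · K^{(n_x²,n_x^l)}
of Ā. -/
def midAbar (s l : ℕ) (P : Matrix (Fin ((2 ^ s) ^ 2)) (Fin ((2 ^ s) ^ 2)) ℂ) :
    Matrix (Fin ((2 ^ s) ^ (l + 2))) (Fin ((2 ^ s) ^ (l + 2))) ℂ :=
  mcast (by ring) (by ring)
      (kron (1 : Matrix (Fin (2 ^ s)) (Fin (2 ^ s)) ℂ) (commMat ((2 ^ s) ^ l) (2 ^ s))) *
    mcast (by ring) (by ring) (kron P (1 : Matrix (Fin ((2 ^ s) ^ l)) (Fin ((2 ^ s) ^ l)) ℂ)) *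
    mcast (by ring) (by ring) (commMat ((2 ^ s) ^ 2) ((2 ^ s) ^ l))

/-- 𝒜 = (ρ_{r_0} ⊗ ⋯ ⊗ ρ_{r_{Q1−1}}) ⊗
  [(τ0^{⊗s} ⊗ K^{(n_x^l,n_x)}) · (𝒟P ⊗ I_{n_x}^{⊗l}) · K^{(n_x²,n_x^l)}] ⊗ I_{n_x}^{⊗(j−l−1)}. -/
def Afull (s Q1 l j : ℕ) (r : Fin Q1 → Fin 5)
    (P : Matrix (Fin ((2 ^ s) ^ 2)) (Fin ((2 ^ s) ^ 2)) ℂ) :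
    Matrix (Fin (2 ^ Q1 * ((2 ^ s) ^ (l + 2) * (2 ^ s) ^ (j - l - 1))))
      (Fin (2 ^ Q1 * ((2 ^ s) ^ (l + 2) * (2 ^ s) ^ (j - l - 1)))) ℂ :=
  kron (kronSeq Q1 fun k => ρ (r k))
    (kron (midA s l P) (kronPow (1 : Matrix (Fin (2 ^ s)) (Fin (2 ^ s)) ℂ) (j - l - 1)))

/-- Ā = (ρ̄_{r_0} ⊗ ⋯ ⊗ ρ̄_{r_{Q1−1}}) ⊗
  [(I_{n_x} ⊗ K^{(n_x^l,n_x)}) · (P ⊗ I_{n_x}^{⊗l}) · K^{(n_x²,n_x^l)}] ⊗ I_{n_x}^{⊗(j−l−1)}. -/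
def Abarfull (s Q1 l j : ℕ) (r : Fin Q1 → Fin 5)
    (P : Matrix (Fin ((2 ^ s) ^ 2)) (Fin ((2 ^ s) ^ 2)) ℂ) :
    Matrix (Fin (2 ^ Q1 * ((2 ^ s) ^ (l + 2) * (2 ^ s) ^ (j - l - 1))))
      (Fin (2 ^ Q1 * ((2 ^ s) ^ (l + 2) * (2 ^ s) ^ (j - l - 1)))) ℂ :=
  kron (kronSeq Q1 fun k => ρbar (r k))
    (kron (midAbar s l P) (kronPow (1 : Matrix (Fin (2 ^ s)) (Fin (2 ^ s)) ℂ) (j - l - 1)))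

open scoped Kronecker

section Kron

lemma kron_eq_submatrix {m n p q : ℕ} (A : Matrix (Fin m) (Fin n) ℂ)
    (B : Matrix (Fin p) (Fin q) ℂ) :
    kron A B = (A ⊗ₖ B).submatrix finProdFinEquiv.symm finProdFinEquiv.symm := rfl

lemma kron_mul_kron {a b c d e f : ℕ} (A : Matrix (Fin a) (Fin b) ℂ) (A' : Matrix (Fin b) (Fin c) ℂ)
    (B : Matrix (Fin d) (Fin e) ℂ) (B' : Matrix (Fin e) (Fin f) ℂ) :
    kron A B * kron A' B' = kron (A * A') (B * B') := by
  simp only [kron_eq_submatrix, submatrix_mul_equiv, mul_kronecker_mul]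

lemma kron_one_one (m n : ℕ) :
    kron (1 : Matrix (Fin m) (Fin m) ℂ) (1 : Matrix (Fin n) (Fin n) ℂ) = 1 := by
  rw [kron_eq_submatrix, one_kronecker_one, submatrix_one_equiv]

lemma conjTranspose_kron {m n p q : ℕ} (A : Matrix (Fin m) (Fin n) ℂ)
    (B : Matrix (Fin p) (Fin q) ℂ) : (kron A B)ᴴ = kron Aᴴ Bᴴ := by
  simp only [kron_eq_submatrix, conjTranspose_submatrix, conjTranspose_kronecker]

lemma mcast_kron_kron {a b c d e f : ℕ} (A : Matrix (Fin a) (Fin b) ℂ)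
    (B : Matrix (Fin c) (Fin d) ℂ) (C : Matrix (Fin e) (Fin f) ℂ) :
    mcast (Nat.mul_assoc a c e) (Nat.mul_assoc b d f) (kron (kron A B) C) =
      kron A (kron B C) := by
  have hdiv {x y z : ℕ} (i : Fin (x * (y * z))) :
      (Fin.cast (Nat.mul_assoc x y z).symm i).divNat.divNat = i.divNat := by
    ext; simp [Nat.div_div_eq_div_mul, Nat.mul_comm]
  have hmid {x y z : ℕ} (i : Fin (x * (y * z))) :
      (Fin.cast (Nat.mul_assoc x y z).symm i).divNat.modNat = i.modNat.divNat := by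
    ext; simp [Nat.mod_mul_left_div_self]
  have hmod {x y z : ℕ} (i : Fin (x * (y * z))) :
      (Fin.cast (Nat.mul_assoc x y z).symm i).modNat = i.modNat.modNat := by
    ext; simp
  ext i j
  simp only [mcast, kron, submatrix_apply, of_apply, hdiv, hmid, hmod, mul_assoc]

lemma kronPow_one {n : ℕ} (l : ℕ) : kronPow (1 : Matrix (Fin n) (Fin n) ℂ) l = 1 := by
  induction l with
  | zero => rfl
  | succ l ih => rw [kronPow, ih]; exact kron_one_one _ _

end Kron

section Mcast

lemma mcast_mul_mcast {a b c a' b' c' : ℕ} (ha : a = a') (hb : b = b') (hc : c = c')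
    (A : Matrix (Fin a) (Fin b) ℂ) (B : Matrix (Fin b) (Fin c) ℂ) :
    mcast ha hb A * mcast hb hc B = mcast ha hc (A * B) := by
  subst ha hb hc; rfl

lemma conjTranspose_mcast {a b a' b' : ℕ} (ha : a = a') (hb : b = b')
    (A : Matrix (Fin a) (Fin b) ℂ) : (mcast ha hb A)ᴴ = mcast hb ha Aᴴ := rfl

lemma mcast_one {a b : ℕ} (h : a = b) : mcast h h (1 : Matrix (Fin a) (Fin a) ℂ) = 1 := by
  subst h; rfl

lemma kron_mcast_left {a b c d a' b' : ℕ} (ha : a = a') (hb : b = b')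
    (A : Matrix (Fin a) (Fin b) ℂ) (B : Matrix (Fin c) (Fin d) ℂ) :
    kron (mcast ha hb A) B = mcast (by rw [ha]) (by rw [hb]) (kron A B) := by
  subst ha hb; rfl

end Mcast

section Unitary

lemma mul_conjTranspose_kron {m n : ℕ} {A : Matrix (Fin m) (Fin m) ℂ}
    {B : Matrix (Fin n) (Fin n) ℂ} (hA : A * Aᴴ = 1) (hB : B * Bᴴ = 1) :
    kron A B * (kron A B)ᴴ = 1 := by
  rw [conjTranspose_kron, kron_mul_kron, hA, hB, kron_one_one]

lemma mul_conjTranspose_mcast {m n : ℕ} (h : m = n) {A : Matrix (Fin m) (Fin m) ℂ}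
    (hA : A * Aᴴ = 1) : mcast h h A * (mcast h h A)ᴴ = 1 := by
  rw [conjTranspose_mcast, mcast_mul_mcast, hA, mcast_one]

lemma mul_conjTranspose_mul {m : ℕ} {A B : Matrix (Fin m) (Fin m) ℂ}
    (hA : A * Aᴴ = 1) (hB : B * Bᴴ = 1) : A * B * (A * B)ᴴ = 1 := by
  rw [conjTranspose_mul, mul_assoc, ← mul_assoc B, hB, one_mul, hA]

lemma IsPermMatrix.mul_conjTranspose {N : ℕ} {P : Matrix (Fin N) (Fin N) ℂ}
    (hP : IsPermMatrix P) : P * Pᴴ = 1 := by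
  obtain ⟨h01, hrow, hcol⟩ := hP
  choose f hf hf' using hrow
  have hPf (i j) : P i j = if j = f i then 1 else 0 := by
    split_ifs with h
    · rw [h]; exact hf i
    · exact (h01 i j).resolve_right fun h' => h (hf' i j h')
  have hinj : Function.Injective f := fun i k h =>
    (hcol (f i)).unique (hf i) (h ▸ hf k)
  ext i k
  simp [mul_apply, conjTranspose_apply, hPf, one_apply, hinj.eq_iff, apply_ite, eq_comm]

lemma commMat_mul_conjTranspose (a b : ℕ) : commMat a b * (commMat a b)ᴴ = 1 := by
  let e : Fin (a * b) ≃ Fin (a * b) :=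
    ((finProdFinEquiv.symm.trans (Equiv.prodComm _ _)).trans finProdFinEquiv).trans
      (finCongr (Nat.mul_comm b a))
  have h : commMat a b = (1 : Matrix _ _ ℂ).submatrix id e := by
    ext i j
    simp [commMat, one_apply, Fin.ext_iff, e, finProdFinEquiv, Nat.add_comm]
  rw [h, conjTranspose_submatrix, submatrix_mul_equiv]
  simp

end Unitary

/-- `B` is unitary and `A` is obtained from `B` by applying an orthogonal projection on the left. -/
def IsCompletedBy {n : ℕ} (A B : Matrix (Fin n) (Fin n) ℂ) : Prop :=
  B * Bᴴ = 1 ∧ ∃ D : Matrix (Fin n) (Fin n) ℂ, Dᴴ = D ∧ D * D = D ∧ A = D * B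

namespace IsCompletedBy

lemma one (n : ℕ) : IsCompletedBy (1 : Matrix (Fin n) (Fin n) ℂ) 1 :=
  ⟨by simp, 1, by simp, by simp, by simp⟩

lemma kron {m n : ℕ} {A B : Matrix (Fin m) (Fin m) ℂ} {A' B' : Matrix (Fin n) (Fin n) ℂ}
    (h : IsCompletedBy A B) (h' : IsCompletedBy A' B') :
    IsCompletedBy (_root_.kron A A') (_root_.kron B B') := by
  obtain ⟨hB, D, hD, hDD, rfl⟩ := h
  obtain ⟨hB', D', hD', hDD', rfl⟩ := h'
  refine ⟨mul_conjTranspose_kron hB hB', _root_.kron D D', ?_, ?_, ?_⟩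
  · rw [conjTranspose_kron, hD, hD']
  · rw [kron_mul_kron, hDD, hDD']
  · rw [kron_mul_kron]

lemma kronSeq {Q : ℕ} {f g : Fin Q → Matrix (Fin 2) (Fin 2) ℂ}
    (h : ∀ k, IsCompletedBy (f k) (g k)) :
    IsCompletedBy (_root_.kronSeq Q f) (_root_.kronSeq Q g) := by
  induction Q with
  | zero => exact one _
  | succ Q ih => exact (ih fun k => h k.castSucc).kron (h (Fin.last Q))

lemma fromBlocks_mul_conjTranspose {n : ℕ} {A B : Matrix (Fin n) (Fin n) ℂ}
    (h : IsCompletedBy A B) :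
    fromBlocks (B - A) A A (B - A) * (fromBlocks (B - A) A A (B - A))ᴴ = 1 := by
  obtain ⟨hB, D, hD, hDD, rfl⟩ := h
  have h₁ : D * B * (D * B)ᴴ = D := by
    rw [conjTranspose_mul, hD, mul_assoc, ← mul_assoc B, hB, one_mul, hDD]
  have h₂ : B * (D * B)ᴴ = D := by
    rw [conjTranspose_mul, hD, ← mul_assoc, hB, one_mul]
  have h₃ : D * B * Bᴴ = D := by rw [mul_assoc, hB, mul_one]
  rw [fromBlocks_conjTranspose, fromBlocks_multiply, ← fromBlocks_one]
  simp only [conjTranspose_sub, sub_mul, mul_sub, hB, h₁, h₂, h₃]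
  congr 1 <;> abel

end IsCompletedBy

lemma τ_zero_isStarProjection : (τ 0)ᴴ = τ 0 ∧ τ 0 * τ 0 = τ 0 := by
  constructor <;> ext i j <;> fin_cases i <;> fin_cases j <;> simp [τ, mul_apply]

lemma τ_three_isStarProjection : (τ 3)ᴴ = τ 3 ∧ τ 3 * τ 3 = τ 3 := by
  constructor <;> ext i j <;> fin_cases i <;> fin_cases j <;> simp [τ, mul_apply]

lemma isCompletedBy_ρ (k : Fin 5) : IsCompletedBy (ρ k) (ρbar k) := by
  have hσ : σx * σxᴴ = 1 := by
    ext i j; fin_cases i <;> fin_cases j <;> simp [σx, mul_apply]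
  fin_cases k
  · exact ⟨by simp [ρbar], τ 0, τ_zero_isStarProjection.1, τ_zero_isStarProjection.2,
      by simp [ρ, ρbar, τ]⟩
  · exact ⟨hσ, τ 0, τ_zero_isStarProjection.1, τ_zero_isStarProjection.2,
      by simp [ρ, ρbar, τ, σx]⟩
  · exact ⟨hσ, τ 3, τ_three_isStarProjection.1, τ_three_isStarProjection.2,
      by simp [ρ, ρbar, τ, σx]⟩
  · exact ⟨by simp [ρbar], τ 3, τ_three_isStarProjection.1, τ_three_isStarProjection.2,
      by simp [ρ, ρbar, τ]⟩
  · exact IsCompletedBy.one 2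

lemma kronPow_τ_zero_isStarProjection (s : ℕ) : (kronPow (τ 0) s)ᴴ = kronPow (τ 0) s ∧
    kronPow (τ 0) s * kronPow (τ 0) s = kronPow (τ 0) s := by
  induction s with
  | zero => simp [kronPow]
  | succ s ih =>
    have h₁ := conjTranspose_kron (kronPow (τ 0) s) (τ 0)
    have h₂ := kron_mul_kron (kronPow (τ 0) s) (kronPow (τ 0) s) (τ 0) (τ 0)
    rw [ih.1, τ_zero_isStarProjection.1] at h₁
    rw [ih.2, τ_zero_isStarProjection.2] at h₂
    exact ⟨h₁, h₂⟩

lemma mcast_kron_Dmat_one (s l : ℕ) (h : (2 ^ s) ^ 2 * (2 ^ s) ^ l = (2 ^ s) ^ (l + 2))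
    (h' : 2 ^ s * ((2 ^ s) ^ l * 2 ^ s) = (2 ^ s) ^ (l + 2)) :
    mcast h h (kron (Dmat s) (1 : Matrix (Fin ((2 ^ s) ^ l)) (Fin ((2 ^ s) ^ l)) ℂ)) =
      mcast h' h' (kron (kronPow (τ 0) s) 1) := by
  have key (p : ℕ) (hp : 2 ^ s * (2 ^ s) ^ l = p) (hp' : 2 ^ s * p = (2 ^ s) ^ (l + 2)) :
      mcast h h (kron (Dmat s) (1 : Matrix (Fin ((2 ^ s) ^ l)) (Fin ((2 ^ s) ^ l)) ℂ)) =
        mcast hp' hp' (kron (kronPow (τ 0) s) (1 : Matrix (Fin p) (Fin p) ℂ)) := by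
    subst hp
    rw [← kron_one_one, ← mcast_kron_kron, Dmat, kron_mcast_left]
    rfl
  exact key _ (Nat.mul_comm _ _) h'

lemma isCompletedBy_mid (s l : ℕ) {P : Matrix (Fin ((2 ^ s) ^ 2)) (Fin ((2 ^ s) ^ 2)) ℂ}
    (hP : IsPermMatrix P) : IsCompletedBy (midA s l P) (midAbar s l P) := by
  have h : 2 ^ s * ((2 ^ s) ^ l * 2 ^ s) = (2 ^ s) ^ (l + 2) := by ring
  obtain ⟨hT, hTT⟩ := kronPow_τ_zero_isStarProjection s
  refine ⟨?_, mcast h h (kron (kronPow (τ 0) s) 1), ?_, ?_, ?_⟩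
  · exact mul_conjTranspose_mul
      (mul_conjTranspose_mul
        (mul_conjTranspose_mcast _
          (mul_conjTranspose_kron (by simp) (commMat_mul_conjTranspose _ _)))
        (mul_conjTranspose_mcast _
          (mul_conjTranspose_kron hP.mul_conjTranspose (by simp))))
      (mul_conjTranspose_mcast _ (commMat_mul_conjTranspose _ _))
  · rw [conjTranspose_mcast, conjTranspose_kron, hT, conjTranspose_one]
  · rw [mcast_mul_mcast, kron_mul_kron, hTT, one_mul]
  · have hD : kron (Dmat s * P) (1 : Matrix (Fin ((2 ^ s) ^ l)) (Fin ((2 ^ s) ^ l)) ℂ) =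
        kron (Dmat s) 1 * kron P 1 := by rw [kron_mul_kron, one_mul]
    have h' : (2 ^ s) ^ 2 * (2 ^ s) ^ l = (2 ^ s) ^ (l + 2) := by ring
    rw [midA, midAbar, hD, ← mcast_mul_mcast h' h' h', mcast_kron_Dmat_one s l h' h]
    simp only [← mul_assoc]
    rw [mcast_mul_mcast, mcast_mul_mcast, kron_mul_kron, kron_mul_kron, hTT, mul_one, mul_one,
      one_mul]

/-- With 𝒜, Ā, and 𝒜^c = Ā − 𝒜 as defined, the block matrix
U = [[𝒜^c, 𝒜],[𝒜, 𝒜^c]] is unitary; in particular Ā is a unitary completion of 𝒜. -/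
theorem statement1 (s Q1 l j : ℕ) (hs : 1 ≤ s) (hjl : l + 1 ≤ j) (r : Fin Q1 → Fin 5)
    (P : Matrix (Fin ((2 ^ s) ^ 2)) (Fin ((2 ^ s) ^ 2)) ℂ) (hP : IsPermMatrix P) :
    let 𝒜 := Afull s Q1 l j r P
    let Abar := Abarfull s Q1 l j r P
    let Ac := Abar - 𝒜
    let U := Matrix.fromBlocks Ac 𝒜 𝒜 Ac
    U * Uᴴ = 1 ∧ Uᴴ * U = 1 := by
  intro 𝒜 Abar Ac U
  have hA : IsCompletedBy 𝒜 Abar :=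
    (IsCompletedBy.kronSeq fun k => isCompletedBy_ρ (r k)).kron
      ((isCompletedBy_mid s l hP).kron (by rw [kronPow_one]; exact IsCompletedBy.one _))
  have hU : U * Uᴴ = 1 := hA.fromBlocks_mul_conjTranspose
  exact ⟨hU, mul_eq_one_comm.mp hU⟩
end
end

section
/- Let s ≥ 1, n_x = 2^s, l ≥ 0, and let F ∈ ℂ^{n_x×n_x²} be arbitrary; let F̃ ∈ ℂ^{n_x²×n_x²} be the matrix whose first n_x rows equal F and whose remaining rows are zero. Then the n_x^{l+2}×n_x^{l+2} matrix whose first n_x^{l+1} rows equal K^{(n_x^l,n_x)} · (F ⊗ I_{n_x}^{⊗l}) · K^{(n_x²,n_x^l)} and whose remaining rows are zero equals (τ0^{⊗s} ⊗ K^{(n_x^l,n_x)}) · (F̃ ⊗ I_{n_x}^{⊗l}) · K^{(n_x²,n_x^l)}. -/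
noncomputable section
open Matrix BigOperators Finset

/-- The `b × c` matrix whose first rows are those of `M` and whose remaining rows are 0. -/
def padTop {a c : ℕ} (b : ℕ) (M : Matrix (Fin a) (Fin c) ℂ) : Matrix (Fin b) (Fin c) ℂ :=
  Matrix.of fun i j => if h : (i : ℕ) < a then M ⟨i, h⟩ j else 0

/-- The `b × d` matrix whose entries in the first `a` rows and first `c` columns are
those of `M` and whose other entries are 0. -/
def pad2 {a c : ℕ} (b d : ℕ) (M : Matrix (Fin a) (Fin c) ℂ) : Matrix (Fin b) (Fin d) ℂ :=
  Matrix.of fun i j => if h : (i : ℕ) < a ∧ (j : ℕ) < c then M ⟨i, h.1⟩ ⟨j, h.2⟩ else 0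

theorem size1 {a j l : ℕ} (h : l < j) : a ^ l * (a * a ^ (j - l - 1)) = a ^ j := by
  rw [← pow_succ', ← pow_add]; congr 1; omega

theorem size2 {a j l : ℕ} (h : l < j) : a ^ l * (a ^ 2 * a ^ (j - l - 1)) = a ^ (j + 1) := by
  rw [← pow_add, ← pow_add]; congr 1; omega

theorem size3 {a j l : ℕ} (h : l < j) : a ^ (l + 2) * a ^ (j - l - 1) = a ^ (j + 1) := by
  rw [← pow_add]; congr 1; omega

theorem kronPow_tau_zero_apply (s : ℕ) (i j : Fin (2 ^ s)) :
    kronPow (τ 0) s i j = if (i : ℕ) = 0 ∧ (j : ℕ) = 0 then 1 else 0 := by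
  induction s with
  | zero =>
    have hi : (i : ℕ) = 0 := Nat.lt_one_iff.mp i.isLt
    have hj : (j : ℕ) = 0 := Nat.lt_one_iff.mp j.isLt
    have hij : i = j := Fin.ext (hi.trans hj.symm)
    subst hij
    simp [kronPow]
  | succ s ih =>
    have tau_apply : ∀ a b : Fin 2,
        τ 0 a b = if (a : ℕ) = 0 ∧ (b : ℕ) = 0 then 1 else 0 := by
      intro a b
      fin_cases a <;> fin_cases b <;> simp [τ]
    have hz : ∀ n : ℕ, n = 0 ↔ n / 2 = 0 ∧ n % 2 = 0 := by omega
    change kronPow (τ 0) s (Fin.divNat (n := 2) i) (Fin.divNat (n := 2) j) *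
      τ 0 (Fin.modNat (n := 2) i) (Fin.modNat (n := 2) j) = _
    rw [ih, tau_apply, ite_zero_mul_ite_zero, mul_one]
    refine if_congr ?_ rfl rfl
    change ((i : ℕ) / 2 = 0 ∧ (j : ℕ) / 2 = 0) ∧ ((i : ℕ) % 2 = 0 ∧ (j : ℕ) % 2 = 0) ↔ _
    rw [and_and_and_comm, ← hz, ← hz]

theorem padTop_mul {a b c d : ℕ} (A : Matrix (Fin a) (Fin c) ℂ) (B : Matrix (Fin c) (Fin d) ℂ) :
    padTop b (A * B) = padTop b A * B := by
  ext i j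
  by_cases h : (i : ℕ) < a <;> simp [padTop, Matrix.mul_apply, h]

theorem pad2_mul_padTop {a b c d e : ℕ} (hc : c ≤ d) (A : Matrix (Fin a) (Fin c) ℂ)
    (G : Matrix (Fin c) (Fin e) ℂ) : pad2 b d A * padTop d G = padTop b (A * G) := by
  obtain ⟨d, rfl⟩ := Nat.exists_eq_add_of_le hc
  ext i j
  by_cases h : (i : ℕ) < a <;> simp [pad2, padTop, Matrix.mul_apply, Fin.sum_univ_add, h]

theorem mcast_kron_padTop {a b c p q m n m' : ℕ} (F : Matrix (Fin a) (Fin c) ℂ)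
    (B : Matrix (Fin p) (Fin q) ℂ) (hm : b * p = m) (hn : c * q = n) (hm' : a * p = m') :
    mcast hm hn (kron (padTop b F) B) = padTop m (mcast hm' hn (kron F B)) := by
  subst hm hn hm'
  ext i j
  have hp : 0 < p := Nat.pos_of_ne_zero (by rintro rfl; exact absurd i.isLt (by simp))
  have hlt : (i : ℕ) / p < a ↔ (i : ℕ) < a * p := Nat.div_lt_iff_lt_mul hp
  by_cases h : (i : ℕ) < a * p
  · simp [mcast, kron, padTop, h, hlt]
    rfl
  · simp [mcast, kron, padTop, h, hlt]

theorem mcast_kron_corner {a b p q m n m' n' : ℕ} (D : Matrix (Fin a) (Fin b) ℂ)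
    (hD : ∀ i j, D i j = if (i : ℕ) = 0 ∧ (j : ℕ) = 0 then 1 else 0)
    (C : Matrix (Fin p) (Fin q) ℂ) (hm : a * p = m) (hn : b * q = n) (hm' : p = m')
    (hn' : q = n') :
    mcast hm hn (kron D C) = pad2 m n (mcast hm' hn' C) := by
  subst hm hn hm' hn'
  ext i j
  have hp : 0 < p := Nat.pos_of_ne_zero (by rintro rfl; exact absurd i.isLt (by simp))
  have hq : 0 < q := Nat.pos_of_ne_zero (by rintro rfl; exact absurd j.isLt (by simp))
  by_cases h : (i : ℕ) < p ∧ (j : ℕ) < q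
  · have hmi : Fin.modNat i = ⟨i, h.1⟩ := Fin.ext (Nat.mod_eq_of_lt h.1)
    have hmj : Fin.modNat j = ⟨j, h.2⟩ := Fin.ext (Nat.mod_eq_of_lt h.2)
    simp [mcast, kron, pad2, hD, h, hmi, hmj]
  · simp [hp.ne', hq.ne', mcast, kron, pad2, hD, h]

/-- Let s ≥ 1, n_x = 2^s, l ≥ 0, F ∈ ℂ^{n_x×n_x²}, and let F̃ be F with
zero rows appended to make it n_x²×n_x².  Then the n_x^{l+2}×n_x^{l+2} matrix whose first
n_x^{l+1} rows equal K^{(n_x^l,n_x)} · (F ⊗ I_{n_x}^{⊗l}) · K^{(n_x²,n_x^l)} and whose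
remaining rows are zero equals (τ0^{⊗s} ⊗ K^{(n_x^l,n_x)}) · (F̃ ⊗ I_{n_x}^{⊗l}) · K^{(n_x²,n_x^l)}. -/
theorem statement12 (s l : ℕ) (hs : 1 ≤ s)
    (F : Matrix (Fin (2 ^ s)) (Fin ((2 ^ s) ^ 2)) ℂ) :
    padTop ((2 ^ s) ^ (l + 2))
        ((mcast (by ring) (by ring) (commMat ((2 ^ s) ^ l) (2 ^ s)) :
            Matrix (Fin ((2 ^ s) ^ (l + 1))) (Fin ((2 ^ s) ^ (l + 1))) ℂ) *
          (mcast (by ring) (by ring)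
              (kron F (kronPow (1 : Matrix (Fin (2 ^ s)) (Fin (2 ^ s)) ℂ) l)) :
            Matrix (Fin ((2 ^ s) ^ (l + 1))) (Fin ((2 ^ s) ^ (l + 2))) ℂ) *
          (mcast (by ring) (by ring) (commMat ((2 ^ s) ^ 2) ((2 ^ s) ^ l)) :
            Matrix (Fin ((2 ^ s) ^ (l + 2))) (Fin ((2 ^ s) ^ (l + 2))) ℂ)) =
      (mcast (by ring) (by ring) (kron (kronPow (τ 0) s) (commMat ((2 ^ s) ^ l) (2 ^ s))) :
          Matrix (Fin ((2 ^ s) ^ (l + 2))) (Fin ((2 ^ s) ^ (l + 2))) ℂ) *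
        (mcast (by ring) (by ring)
            (kron (padTop ((2 ^ s) ^ 2) F)
              (kronPow (1 : Matrix (Fin (2 ^ s)) (Fin (2 ^ s)) ℂ) l)) :
          Matrix (Fin ((2 ^ s) ^ (l + 2))) (Fin ((2 ^ s) ^ (l + 2))) ℂ) *
        (mcast (by ring) (by ring) (commMat ((2 ^ s) ^ 2) ((2 ^ s) ^ l)) :
          Matrix (Fin ((2 ^ s) ^ (l + 2))) (Fin ((2 ^ s) ^ (l + 2))) ℂ) := by
  rw [padTop_mul]
  congr 1
  have hrow : (2 ^ s) ^ l * 2 ^ s = (2 ^ s) ^ (l + 1) := by ring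
  have hrow' : 2 ^ s * (2 ^ s) ^ l = (2 ^ s) ^ (l + 1) := by ring
  rw [mcast_kron_corner _ (kronPow_tau_zero_apply s) _ _ _ hrow hrow,
    mcast_kron_padTop _ _ _ _ hrow',
    pad2_mul_padTop (Nat.pow_le_pow_right (by positivity) (by omega))]
end
end

section
/- Let s ≥ 2, n_x = 2^s, and Δx > 0. Define F₂ ∈ ℂ^{n_x×n_x²} by (F₂)_{j,k} = −1/(2Δx) if k = n_x·j + ((j+1) mod n_x), (F₂)_{j,k} = 1/(2Δx) if k = n_x·j + ((j−1) mod n_x), and 0 otherwise, and let F̃₂ ∈ ℂ^{n_x²×n_x²} be F₂ stacked above a zero block. Then: (a) the maps j ↦ n_x·j + ((j+1) mod n_x) and j ↦ n_x·j + ((j−1) mod n_x) are injective on {0,…,n_x−1}, so there exist n_x²×n_x² permutation matrices P⁺ and P⁻ with (P⁺)_{j, n_x·j + ((j+1) mod n_x)} = 1 and (P⁻)_{j, n_x·j + ((j−1) mod n_x)} = 1 for all 0 ≤ j < n_x; and (b) for every such pair P⁺, P⁻ one has F̃₂ = −(𝒟·P⁺ − 𝒟·P⁻)/(2Δx), where 𝒟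 = τ0^{⊗s} ⊗ I_{n_x}. -/
noncomputable section
open Matrix BigOperators Finset

theorem idx_lt {a j r : ℕ} (hj : j < a) (hr : r < a) : a * j + r < a ^ 2 := by nlinarith

/-- The matrix F₂ of the quadratic term of the centered discretization of the 1D
Burgers' equation with periodic boundary conditions:
(F₂)_{j, n_x·j+((j+1) mod n_x)} = −1/(2Δx), (F₂)_{j, n_x·j+((j−1) mod n_x)} = 1/(2Δx),
all other entries 0. -/
def F2mat (s : ℕ) (dx : ℝ) : Matrix (Fin (2 ^ s)) (Fin ((2 ^ s) ^ 2)) ℂ :=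
  Matrix.of fun j k =>
    if (k : ℕ) = 2 ^ s * (j : ℕ) + (((j : ℕ) + 1) % 2 ^ s) then -(1 / (2 * (dx : ℂ)))
    else if (k : ℕ) = 2 ^ s * (j : ℕ) + (((j : ℕ) + 2 ^ s - 1) % 2 ^ s) then 1 / (2 * (dx : ℂ))
    else 0

/-- Row index `j`, viewed inside `Fin (n_x²)`. -/
def rowIdx (s : ℕ) (j : Fin (2 ^ s)) : Fin ((2 ^ s) ^ 2) :=
  ⟨(j : ℕ), lt_of_lt_of_le j.isLt (Nat.le_self_pow (by norm_num) _)⟩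

/-- Column index `n_x·j + ((j+1) mod n_x)`. -/
def colP (s : ℕ) (j : Fin (2 ^ s)) : Fin ((2 ^ s) ^ 2) :=
  ⟨2 ^ s * (j : ℕ) + (((j : ℕ) + 1) % 2 ^ s),
    idx_lt j.isLt (Nat.mod_lt _ (pow_pos (by norm_num) s))⟩

/-- Column index `n_x·j + ((j−1) mod n_x)`. -/
def colM (s : ℕ) (j : Fin (2 ^ s)) : Fin ((2 ^ s) ^ 2) :=
  ⟨2 ^ s * (j : ℕ) + (((j : ℕ) + 2 ^ s - 1) % 2 ^ s),
    idx_lt j.isLt (Nat.mod_lt _ (pow_pos (by norm_num) s))⟩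

theorem kron_apply_eq_ite_zero {m p : ℕ} {A : Matrix (Fin m) (Fin m) ℂ}
    {B : Matrix (Fin p) (Fin p) ℂ}
    (hA : ∀ i j, A i j = if (i : ℕ) = 0 ∧ (j : ℕ) = 0 then 1 else 0)
    (hB : ∀ i j, B i j = if (i : ℕ) = 0 ∧ (j : ℕ) = 0 then 1 else 0) (i j : Fin (m * p)) :
    kron A B i j = if (i : ℕ) = 0 ∧ (j : ℕ) = 0 then 1 else 0 := by
  have hz : ∀ x : Fin (m * p), (x : ℕ) = 0 ↔ (x.divNat : ℕ) = 0 ∧ (x.modNat : ℕ) = 0 := fun x => by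
    rw [Fin.coe_divNat, Fin.coe_modNat]
    exact ⟨fun h => by simp [h], fun h => by rw [← Nat.div_add_mod x p, h.1, h.2]; simp⟩
  simp only [kron, Matrix.of_apply, hA, hB, hz]
  split_ifs <;> first | tauto | simp

theorem Dmat_eq_diagonal (s : ℕ) :
    Dmat s = Matrix.diagonal fun i : Fin ((2 ^ s) ^ 2) => if (i : ℕ) < 2 ^ s then 1 else 0 := by
  ext i j
  have hpos : 0 < 2 ^ s := by positivity
  simp only [Dmat, mcast, kron, Matrix.submatrix_apply, Matrix.of_apply,
    kronPow_tau_zero_apply, Matrix.one_apply, Matrix.diagonal_apply, Fin.ext_iff,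
    Fin.coe_divNat, Fin.coe_modNat, Fin.val_cast, Nat.div_eq_zero_iff, hpos.ne', false_or]
  by_cases hi : (i : ℕ) < 2 ^ s
  · by_cases hj : (j : ℕ) < 2 ^ s
    · simp [hi, hj, Nat.mod_eq_of_lt]
    · have hij : (i : ℕ) ≠ j := by omega
      simp [hj, hij]
  · simp [hi]

theorem IsPermMatrix.apply_eq_ite {N : ℕ} {P : Matrix (Fin N) (Fin N) ℂ} (hP : IsPermMatrix P)
    {i j : Fin N} (hij : P i j = 1) (k : Fin N) : P i k = if k = j then 1 else 0 := by
  split_ifs with h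
  · rw [h, hij]
  · exact (hP.1 i k).resolve_right fun hk => h ((hP.2.1 i).unique hk hij)

theorem isPermMatrix_of_perm {N : ℕ} (σ : Equiv.Perm (Fin N)) :
    IsPermMatrix (Matrix.of fun i j => if σ i = j then (1 : ℂ) else 0) := by
  refine ⟨fun i j => ?_, fun i => ⟨σ i, by simp, by simp [eq_comm]⟩,
    fun j => ⟨σ.symm j, by simp, fun i hi => ?_⟩⟩
  · by_cases h : σ i = j <;> simp [h]
  · have hσ : σ i = j := by simpa using hi
    simp [← hσ]

theorem exists_isPermMatrix_of_injective {ι : Type*} [Finite ι] {N : ℕ} {f g : ι → Fin N}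
    (hf : Function.Injective f) (hg : Function.Injective g) :
    ∃ P : Matrix (Fin N) (Fin N) ℂ, IsPermMatrix P ∧ ∀ x, P (f x) (g x) = 1 := by
  obtain ⟨σ, hσ⟩ := Equiv.Perm.exists_extending_pair f g hf hg
  exact ⟨_, isPermMatrix_of_perm σ, fun x => by simp [hσ]⟩

theorem injective_mul_add_of_lt {n : ℕ} {r : Fin n → ℕ} (hr : ∀ j, r j < n) :
    Function.Injective fun j : Fin n => n * (j : ℕ) + r j := by
  intro a b h
  have hdiv : ∀ j : Fin n, (n * (j : ℕ) + r j) / n = j := fun j => by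
    rw [Nat.mul_add_div (Nat.zero_lt_of_lt (hr j)), Nat.div_eq_of_lt (hr j), add_zero]
  have h' : n * (a : ℕ) + r a = n * (b : ℕ) + r b := h
  exact Fin.ext (by rw [← hdiv a, ← hdiv b, h'])

theorem succ_mod_ne_pred_mod {n j : ℕ} (hn : 2 < n) :
    (j + 1) % n ≠ (j + n - 1) % n := by
  intro h
  have h' : j + 1 ≡ j + 1 + (n - 2) [MOD n] := by
    have e : j + 1 + (n - 2) = j + n - 1 := by omega
    rw [e]
    exact h
  have h0 : n - 2 ≡ 0 [MOD n] := (Nat.ModEq.add_left_cancel' (j + 1) h').symm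
  have := Nat.le_of_dvd (by omega) ((Nat.modEq_zero_iff_dvd).1 h0)
  omega

/-- (a) The maps j ↦ n_x·j + ((j±1) mod n_x) are injective, so there
exist permutation matrices P⁺, P⁻ with (P⁺)_{j, n_x·j+((j+1) mod n_x)} = 1 and
(P⁻)_{j, n_x·j+((j−1) mod n_x)} = 1; and (b) for every such pair,
F̃₂ = −(𝒟·P⁺ − 𝒟·P⁻)/(2Δx) where 𝒟 = τ0^{⊗s} ⊗ I_{n_x}. -/
theorem statement13 (s : ℕ) (hs : 2 ≤ s) (dx : ℝ) (hdx : 0 < dx) :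
    (Function.Injective fun j : Fin (2 ^ s) =>
      2 ^ s * (j : ℕ) + (((j : ℕ) + 1) % 2 ^ s)) ∧
    (Function.Injective fun j : Fin (2 ^ s) =>
      2 ^ s * (j : ℕ) + (((j : ℕ) + 2 ^ s - 1) % 2 ^ s)) ∧
    (∃ Pp Pm : Matrix (Fin ((2 ^ s) ^ 2)) (Fin ((2 ^ s) ^ 2)) ℂ,
      IsPermMatrix Pp ∧ IsPermMatrix Pm ∧
        (∀ j : Fin (2 ^ s), Pp (rowIdx s j) (colP s j) = 1) ∧
        (∀ j : Fin (2 ^ s), Pm (rowIdx s j) (colM s j) = 1)) ∧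
    (∀ Pp Pm : Matrix (Fin ((2 ^ s) ^ 2)) (Fin ((2 ^ s) ^ 2)) ℂ,
      IsPermMatrix Pp → IsPermMatrix Pm →
        (∀ j : Fin (2 ^ s), Pp (rowIdx s j) (colP s j) = 1) →
        (∀ j : Fin (2 ^ s), Pm (rowIdx s j) (colM s j) = 1) →
        padTop ((2 ^ s) ^ 2) (F2mat s dx) =
          -(1 / (2 * (dx : ℂ))) • (Dmat s * Pp - Dmat s * Pm)) := by
  have hpos : 0 < 2 ^ s := by positivity
  have hn : 2 < 2 ^ s := lt_of_lt_of_le (by norm_num) (Nat.pow_le_pow_right two_pos hs)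
  have hP : Function.Injective fun j : Fin (2 ^ s) =>
      2 ^ s * (j : ℕ) + (((j : ℕ) + 1) % 2 ^ s) :=
    injective_mul_add_of_lt fun _ => Nat.mod_lt _ hpos
  have hM : Function.Injective fun j : Fin (2 ^ s) =>
      2 ^ s * (j : ℕ) + (((j : ℕ) + 2 ^ s - 1) % 2 ^ s) :=
    injective_mul_add_of_lt fun _ => Nat.mod_lt _ hpos
  have hrow : Function.Injective (rowIdx s) := fun a b h => Fin.ext (Fin.mk.inj h)
  refine ⟨hP, hM, ?_, ?_⟩
  · obtain ⟨Pp, hPp, hPp1⟩ := exists_isPermMatrix_of_injective hrow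
      (g := colP s) fun a b h => hP (congrArg Fin.val h)
    obtain ⟨Pm, hPm, hPm1⟩ := exists_isPermMatrix_of_injective hrow
      (g := colM s) fun a b h => hM (congrArg Fin.val h)
    exact ⟨Pp, Pm, hPp, hPm, hPp1, hPm1⟩
  · intro Pp Pm hPp hPm hPp1 hPm1
    ext i k
    simp only [padTop, Matrix.of_apply, Dmat_eq_diagonal, Matrix.smul_apply, Matrix.sub_apply,
      Matrix.diagonal_mul, smul_eq_mul]
    by_cases hi : (i : ℕ) < 2 ^ s
    · have hrowi : i = rowIdx s ⟨i, hi⟩ := rfl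
      have hp := hPp.apply_eq_ite (hPp1 ⟨i, hi⟩) k
      have hm := hPm.apply_eq_ite (hPm1 ⟨i, hi⟩) k
      rw [← hrowi] at hp hm
      have hne := succ_mod_ne_pred_mod (j := i) hn
      simp only [hi, dif_pos, if_true, hp, hm, F2mat, Matrix.of_apply, Fin.ext_iff, colP, colM]
      split_ifs with h1 h2
      · omega
      · ring
      · ring
      · ring
    · simp [hi]
end
end

section
/- Let m, n ≥ 1. For 0 ≤ i < m+n−1 let S(i,i+1) be the transposition of positions i and i+1 in a string of m+n bit positions. Then executing the transpositions S(r+m−q−1, r+m−q), in the order r = 0,…,n−1 and, for each fixed r, q = 0,…,m−1 (each transposition applied to the result of the previous ones), yields the permutation of positions that moves the block of the last n positions m,…,m+n−1 in front of the block of the first m positions 0,…,m−1 (preserving the order within each block). Consequently, the corresponding product of adjacent SWAP permutation matrices on 2^{m+n} basis states equals the commutation matrix K^{(2^m,2^n)}. -/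
noncomputable section
open Matrix

/-- The adjacent transposition S(r+m−q−1, r+m−q) of bit positions. -/
def swapGate (m n : ℕ) (r : Fin n) (q : Fin m) : Equiv.Perm (Fin (m + n)) :=
  Equiv.swap ⟨(r : ℕ) + m - (q : ℕ) - 1, by have := r.isLt; have := q.isLt; omega⟩
    ⟨(r : ℕ) + m - (q : ℕ), by have := r.isLt; have := q.isLt; omega⟩

/-- The list of transpositions S(r+m−q−1, r+m−q), in the order r = 0,…,n−1 and, for
each fixed r, q = 0,…,m−1 (execution order). -/
def gateList (m n : ℕ) : List (Equiv.Perm (Fin (m + n))) :=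
  (List.finRange n).flatMap fun r => (List.finRange m).map fun q => swapGate m n r q

/-- The composite permutation of positions obtained by executing the transpositions in
order (each applied to the result of the previous ones): if the gates are g₁, g₂, …
in execution order, this is g₁ ∘ g₂ ∘ ⋯ (so that the final arrangement sends position
p to the item initially located at position (g₁ ∘ g₂ ∘ ⋯) p). -/
def posPerm (m n : ℕ) : Equiv.Perm (Fin (m + n)) :=
  (gateList m n).foldl (fun acc σ => σ.trans acc) (Equiv.refl _)

/-- The permutation of positions that moves the block of the last n positions in front
of the block of the first m positions, preserving the order within each block. -/
def rotFun (m n : ℕ) (x : Fin (m + n)) : Fin (m + n) :=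
  if h : (x : ℕ) < n then ⟨m + (x : ℕ), by omega⟩
  else ⟨(x : ℕ) - n, by have := x.isLt; omega⟩

/-- The permutation matrix, on the basis states of m+n qubits (bit strings
b₀b₁…b_{m+n−1}, b₀ most significant), of the position permutation σ:
it maps the basis state b to the basis state b ∘ σ⁻¹, i.e. (M v)(b) = v (b ∘ σ). -/
def swapMat (m n : ℕ) (σ : Equiv.Perm (Fin (m + n))) :
    Matrix (Fin (m + n) → Bool) (Fin (m + n) → Bool) ℂ :=
  Matrix.of fun b c => if c = b ∘ σ then 1 else 0

/-- The product of the adjacent SWAP matrices, taken in execution order (the matrix of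
the first executed transposition acts first on vectors). -/
def prodMat (m n : ℕ) : Matrix (Fin (m + n) → Bool) (Fin (m + n) → Bool) ℂ :=
  (gateList m n).foldl (fun acc σ => swapMat m n σ * acc) 1

/-- The Kronecker product x ⊗ y of vectors on the first register (first m positions)
and the second register (last n positions). -/
def vkronStr {m n : ℕ} (x : (Fin m → Bool) → ℂ) (y : (Fin n → Bool) → ℂ) :
    (Fin (m + n) → Bool) → ℂ :=
  fun b => x (fun i => b (Fin.castAdd n i)) * y (fun i => b (Fin.natAdd m i))

theorem prod_map_take_succ_finRange {M : Type*} [Monoid M] {m k : ℕ} (f : Fin m → M)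
    (hk : k < m) :
    (((List.finRange m).take (k + 1)).map f).prod =
      (((List.finRange m).take k).map f).prod * f ⟨k, hk⟩ := by
  rw [List.take_succ_eq_append_getElem (by simpa using hk)]
  simp

/-- The first `k` transpositions of row `r` compose to a cycle moving the item at position
`r + m` down to position `r + m - k`. -/
theorem prod_take_swapGate_apply (m n : ℕ) (r : Fin n) (k : ℕ) (hk : k ≤ m)
    (x : Fin (m + n)) :
    ((((List.finRange m).take k).map (swapGate m n r)).prod x : ℕ) =
      if (x : ℕ) = r + m - k then (r : ℕ) + m
      else if (r : ℕ) + m - k < x ∧ (x : ℕ) ≤ r + m then (x : ℕ) - 1 else x := by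
  induction k generalizing x with
  | zero =>
    simp only [List.take_zero, List.map_nil, List.prod_nil, Equiv.Perm.coe_one, id]
    split_ifs <;> omega
  | succ k ih =>
    rw [prod_map_take_succ_finRange _ hk, Equiv.Perm.mul_apply, ih (by omega), swapGate,
      Equiv.swap_apply_def]
    simp only [Fin.ext_iff]
    split_ifs <;> (try dsimp only at *) <;> omega

theorem prod_swapGate_apply (m n : ℕ) (r : Fin n) (x : Fin (m + n)) :
    (((List.finRange m).map (swapGate m n r)).prod x : ℕ) =
      if (x : ℕ) = r then (r : ℕ) + m
      else if (r : ℕ) < x ∧ (x : ℕ) ≤ r + m then (x : ℕ) - 1 else x := by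
  simpa [List.take_of_length_le] using prod_take_swapGate_apply m n r m le_rfl x

/-- The first `k` rows move the block of positions `m, …, m + k - 1` in front of the block of
the first `m` positions. -/
theorem prod_take_rows_apply (m n k : ℕ) (hk : k ≤ n) (x : Fin (m + n)) :
    ((((List.finRange n).take k).map
        fun r => ((List.finRange m).map (swapGate m n r)).prod).prod x : ℕ) =
      if (x : ℕ) < k then m + (x : ℕ) else if (x : ℕ) < k + m then (x : ℕ) - k else x := by
  induction k generalizing x with
  | zero => simp
  | succ k ih =>
    rw [prod_map_take_succ_finRange _ hk, Equiv.Perm.mul_apply, ih (by omega),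
      prod_swapGate_apply]
    split_ifs <;> (try dsimp only at *) <;> omega

theorem posPerm_eq_prod (m n : ℕ) : posPerm m n = (gateList m n).prod :=
  List.prod_eq_foldl.symm

theorem prod_gateList (m n : ℕ) :
    (gateList m n).prod =
      ((List.finRange n).map fun r => ((List.finRange m).map (swapGate m n r)).prod).prod := by
  simp [gateList, List.flatMap, List.prod_flatten, Function.comp_def]

theorem posPerm_apply (m n : ℕ) (x : Fin (m + n)) : posPerm m n x = rotFun m n x := by
  have h := prod_take_rows_apply m n n le_rfl x
  rw [List.take_of_length_le (by simp), ← prod_gateList, ← posPerm_eq_prod] at h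
  ext
  rw [h, rotFun]
  split_ifs <;> simp only []; omega

theorem swapMat_mulVec (m n : ℕ) (σ : Equiv.Perm (Fin (m + n)))
    (v : (Fin (m + n) → Bool) → ℂ) :
    (swapMat m n σ).mulVec v = fun b => v (b ∘ σ) := by
  ext b
  simp [swapMat, Matrix.mulVec, dotProduct]

theorem foldl_swapMat_mulVec (m n : ℕ) (l : List (Equiv.Perm (Fin (m + n))))
    (hl : ∀ σ ∈ l, σ⁻¹ = σ)
    (A : Matrix (Fin (m + n) → Bool) (Fin (m + n) → Bool) ℂ)
    (v : (Fin (m + n) → Bool) → ℂ) :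
    (l.foldl (fun acc σ => swapMat m n σ * acc) A).mulVec v =
      fun b => A.mulVec v (b ∘ ⇑(l.prod)⁻¹) := by
  induction l generalizing A with
  | nil => rfl
  | cons σ l ih =>
    rw [List.forall_mem_cons] at hl
    rw [List.foldl_cons, ih hl.2, ← Matrix.mulVec_mulVec, swapMat_mulVec, List.prod_cons,
      _root_.mul_inv_rev, hl.1]
    rfl

theorem inv_eq_self_of_mem_gateList {m n : ℕ} {σ : Equiv.Perm (Fin (m + n))}
    (h : σ ∈ gateList m n) : σ⁻¹ = σ := by
  simp only [gateList, List.mem_flatMap, List.mem_map] at h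
  obtain ⟨r, -, q, -, rfl⟩ := h
  exact Equiv.swap_inv _ _

theorem prodMat_mulVec (m n : ℕ) (v : (Fin (m + n) → Bool) → ℂ) :
    (prodMat m n).mulVec v = fun b => v (b ∘ ⇑(posPerm m n)⁻¹) := by
  rw [prodMat, foldl_swapMat_mulVec m n _ (fun _ => inv_eq_self_of_mem_gateList),
    posPerm_eq_prod]
  simp

theorem posPerm_inv_castAdd (m n : ℕ) (i : Fin m) :
    (posPerm m n)⁻¹ (Fin.castAdd n i) = Fin.cast (Nat.add_comm n m) (Fin.natAdd n i) := by
  rw [Equiv.Perm.inv_eq_iff_eq, posPerm_apply]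
  ext
  simp [rotFun]

theorem posPerm_inv_natAdd (m n : ℕ) (j : Fin n) :
    (posPerm m n)⁻¹ (Fin.natAdd m j) = Fin.cast (Nat.add_comm n m) (Fin.castAdd m j) := by
  rw [Equiv.Perm.inv_eq_iff_eq, posPerm_apply]
  ext
  simp [rotFun]

/-- Executing the adjacent transpositions S(r+m−q−1, r+m−q) in the
order r = 0,…,n−1, q = 0,…,m−1 yields the permutation of positions moving the last n
positions in front of the first m; consequently the corresponding product of adjacent
SWAP permutation matrices equals the commutation matrix K^{(2^m,2^n)}, i.e. it maps
x ⊗ y to y ⊗ x for all x, y. -/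
theorem statement16 (m n : ℕ) (hm : 1 ≤ m) (hn : 1 ≤ n) :
    (∀ x : Fin (m + n), posPerm m n x = rotFun m n x) ∧
      (∀ (x : (Fin m → Bool) → ℂ) (y : (Fin n → Bool) → ℂ),
        (prodMat m n).mulVec (vkronStr x y) =
          fun b => vkronStr y x fun i => b (Fin.cast (Nat.add_comm n m) i)) := by
  refine ⟨posPerm_apply m n, fun x y => ?_⟩
  rw [prodMat_mulVec]
  ext b
  simp only [vkronStr, Function.comp_apply, posPerm_inv_castAdd, posPerm_inv_natAdd]
  exact mul_comm _ _
end
end
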